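/- Let A be a pointed category with kernels of normal epimorphisms. Any stable factorisation system (E, M) on A in which every member of E is a normal epimorphism induces a torsion theory (T_E, F_M) in the arrow category Arr(A), where F_M is the full subcategory of Arr(A) determined by the morphisms in M, and T_E is the full subcategory of Arr(A) determined by the morphisms e ∈ E of the form e : T → 0. -/

import Mathlib

open CategoryTheory CategoryTheory.Limits

universe v u v₂ u₂

namespace ProtoPaper

variable {C : Type u} [Category.{v} C]

section ZeroDefs

variable [HasZeroMorphisms C]

/-- `k` is a kernel of `f`. -/
def IsKernelOf {K A B : C} (k : K ⟶ A) (f : A ⟶ B) : Prop :=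
  ∃ w : k ≫ f = 0, Nonempty (IsLimit (KernelFork.ofι k w))

/-- `f` is a cokernel of `k`. -/
def IsCokernelOf {K A B : C} (f : A ⟶ B) (k : K ⟶ A) : Prop :=
  ∃ w : k ≫ f = 0, Nonempty (IsColimit (CokernelCofork.ofπ f w))

/-- A normal monomorphism: a kernel of some morphism. -/
def IsNormalMonoArrow {K A : C} (k : K ⟶ A) : Prop :=
  ∃ (B : C) (f : A ⟶ B), IsKernelOf k f

/-- A normal epimorphism: a cokernel of some morphism. -/
def IsNormalEpiArrow {A B : C} (f : A ⟶ B) : Prop :=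
  ∃ (K : C) (k : K ⟶ A), IsCokernelOf f k

/-- A split short exact sequence `0 → K → A ⇄ B → 0`. -/
structure IsSplitShortExact {K A B : C} (k : K ⟶ A) (f : A ⟶ B) (s : B ⟶ A) : Prop where
  isKernel : IsKernelOf k f
  split : s ≫ f = 𝟙 B

/-- A short exact sequence `0 → K → A → B → 0`. -/
structure IsShortExact {K A B : C} (k : K ⟶ A) (f : A ⟶ B) : Prop where
  isKernel : IsKernelOf k f
  isCokernel : IsCokernelOf f k

/-- A protosplit monomorphism: a kernel of a split epimorphism. -/
def IsProtosplitMono {K A : C} (k : K ⟶ A) : Prop :=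
  ∃ (B : C) (f : A ⟶ B) (s : B ⟶ A), IsSplitShortExact k f s

end ZeroDefs

/-- A pointed category is protomodular when the split short five lemma holds. -/
def IsProtomodular (C : Type u) [Category.{v} C] [HasZeroMorphisms C] : Prop :=
  ∀ ⦃K A B K' A' B' : C⦄ (k : K ⟶ A) (f : A ⟶ B) (s : B ⟶ A)
    (k' : K' ⟶ A') (f' : A' ⟶ B') (s' : B' ⟶ A')
    (κ : K ⟶ K') (α : A ⟶ A') (β : B ⟶ B'),
    IsSplitShortExact k f s → IsSplitShortExact k' f' s' →
    k ≫ α = κ ≫ k' → f ≫ β = α ≫ f' → s ≫ α = β ≫ s' →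
    IsIso κ → IsIso β → IsIso α

section Functors

variable {D : Type u₂} [Category.{v₂} D]

/-- A functor is protoadditive if it preserves split short exact sequences. -/
def IsProtoadditive [HasZeroMorphisms C] [HasZeroMorphisms D] (F : C ⥤ D) : Prop :=
  ∀ ⦃K A B : C⦄ (k : K ⟶ A) (f : A ⟶ B) (s : B ⟶ A),
    IsSplitShortExact k f s → IsSplitShortExact (F.map k) (F.map f) (F.map s)

/-- A functor preserves zero objects. -/
def PreservesZeroObjects (F : C ⥤ D) : Prop :=
  ∀ X : C, IsZero X → IsZero (F.obj X)

/-- A functor preserves pullbacks along split epimorphisms. -/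
def PreservesPullbacksAlongSplitEpis (F : C ⥤ D) : Prop :=
  ∀ ⦃P X Y Z : C⦄ (fst : P ⟶ X) (snd : P ⟶ Y) (f : X ⟶ Z) (g : Y ⟶ Z),
    IsSplitEpi f → IsPullback fst snd f g →
    IsPullback (F.map fst) (F.map snd) (F.map f) (F.map g)

end Functors

/-- A homological category: pointed, protomodular and regular (finitely complete with
pullback-stable (regular epi, mono) factorisations). -/
structure IsHomological (C : Type u) [Category.{v} C] [HasZeroObject C]
    [HasZeroMorphisms C] : Prop where
  protomodular : IsProtomodular C
  hasFiniteLimits : HasFiniteLimits C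
  regEpiMonoFac : ∀ ⦃X Y : C⦄ (f : X ⟶ Y),
    ∃ (I : C) (e : X ⟶ I) (m : I ⟶ Y), Nonempty (RegularEpi e) ∧ Mono m ∧ e ≫ m = f
  regEpiStable : ∀ ⦃P X Y Z : C⦄ (fst : P ⟶ X) (snd : P ⟶ Y) (f : X ⟶ Z) (g : Y ⟶ Z),
    IsPullback fst snd f g → Nonempty (RegularEpi f) → Nonempty (RegularEpi snd)

/-- An internal equivalence relation, given by a jointly monic pair which is internally
reflexive, symmetric and transitive. -/
structure IsInternalEquivRel {R X : C} (p₁ p₂ : R ⟶ X) : Prop where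
  jointlyMono : ∀ ⦃Z : C⦄ (a b : Z ⟶ R), a ≫ p₁ = b ≫ p₁ → a ≫ p₂ = b ≫ p₂ → a = b
  refl : ∃ d : X ⟶ R, d ≫ p₁ = 𝟙 X ∧ d ≫ p₂ = 𝟙 X
  symm : ∃ σ : R ⟶ R, σ ≫ p₁ = p₂ ∧ σ ≫ p₂ = p₁
  trans : ∀ ⦃P : C⦄ (q₁ q₂ : P ⟶ R), IsPullback q₁ q₂ p₂ p₁ →
    ∃ t : P ⟶ R, t ≫ p₁ = q₁ ≫ p₁ ∧ t ≫ p₂ = q₂ ≫ p₂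

/-- A semi-abelian category: homological, with binary coproducts, and exact
(every internal equivalence relation is a kernel pair). -/
structure IsSemiAbelian (C : Type u) [Category.{v} C] [HasZeroObject C]
    [HasZeroMorphisms C] : Prop where
  homological : IsHomological C
  hasBinaryCoproducts : HasBinaryCoproducts C
  equivRelEffective : ∀ ⦃R X : C⦄ (p₁ p₂ : R ⟶ X), IsInternalEquivRel p₁ p₂ →
    ∃ (Y : C) (f : X ⟶ Y), IsPullback p₁ p₂ f f

/-- A full subcategory (given by a predicate on objects) is replete if it is closed
under isomorphisms. -/
def Replete (P : C → Prop) : Prop := ∀ ⦃X Y : C⦄, P X → (X ≅ Y) → P Y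

/-- A reflection of `C` onto the full subcategory of objects satisfying `P`:
a reflector `F`, a unit `η`, landing in `P`, with the usual universal property. -/
structure Reflection (C : Type u) [Category.{v} C] (P : C → Prop) where
  F : C ⥤ C
  η : 𝟭 C ⟶ F
  mem : ∀ X : C, P (F.obj X)
  univ : ∀ ⦃X B : C⦄, P B → ∀ f : X ⟶ B, ∃! g : F.obj X ⟶ B, η.app X ≫ g = f

variable {P : C → Prop}

/-- A (normal epi)-reflection: all units are normal epimorphisms. -/
def NormalEpiUnits [HasZeroMorphisms C] (R : Reflection C P) : Prop :=
  ∀ X : C, IsNormalEpiArrow (R.η.app X)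

/-- `f` is a trivial extension with respect to the reflection `R`. -/
def IsTrivialExt (R : Reflection C P) {A B : C} (f : A ⟶ B) : Prop :=
  IsPullback (R.η.app A) f (R.F.map f) (R.η.app B)

/-- `p` is an effective descent morphism: the pullback functor between the slice
categories is monadic. -/
def IsEffectiveDescent [HasPullbacks C] {E B : C} (p : E ⟶ B) : Prop :=
  Nonempty (MonadicRightAdjoint (Over.pullback p))

/-- A central extension with respect to the (absolute) Galois structure of a reflection:
some pullback along an effective descent morphism is a trivial extension. -/
def IsCentralExt [HasPullbacks C] (R : Reflection C P) {A B : C} (f : A ⟶ B) : Prop :=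
  ∃ (E : C) (p : E ⟶ B), IsEffectiveDescent p ∧
    ∃ (Pb : C) (p1 : Pb ⟶ E) (p2 : Pb ⟶ A), IsPullback p1 p2 p f ∧ IsTrivialExt R p1

/-- A normal extension with respect to the (absolute) Galois structure of a reflection. -/
def IsNormalExt [HasPullbacks C] (R : Reflection C P) {A B : C} (f : A ⟶ B) : Prop :=
  IsEffectiveDescent f ∧
    ∃ (Pb : C) (p1 p2 : Pb ⟶ A), IsPullback p1 p2 f f ∧ IsTrivialExt R p1

/-- A central extension with respect to the Galois structure of a reflection relative to
the class of normal epimorphisms. -/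
def IsCentralExtN [HasZeroMorphisms C] (R : Reflection C P) {A B : C} (f : A ⟶ B) : Prop :=
  IsNormalEpiArrow f ∧ ∃ (E : C) (p : E ⟶ B), IsNormalEpiArrow p ∧
    ∃ (Pb : C) (p1 : Pb ⟶ E) (p2 : Pb ⟶ A), IsPullback p1 p2 p f ∧ IsTrivialExt R p1

/-- A normal extension with respect to the Galois structure of a reflection relative to
the class of normal epimorphisms. -/
def IsNormalExtN [HasZeroMorphisms C] (R : Reflection C P) {A B : C} (f : A ⟶ B) : Prop :=
  IsNormalEpiArrow f ∧
    ∃ (Pb : C) (p1 p2 : Pb ⟶ A), IsPullback p1 p2 f f ∧ IsTrivialExt R p1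

/-- The reflector is semi-left-exact: it preserves pullbacks of units along morphisms
with domain in the subcategory. -/
def SemiLeftExact (R : Reflection C P) : Prop :=
  ∀ ⦃A X Pb : C⦄ (x : X ⟶ R.F.obj A) (p1 : Pb ⟶ A) (p2 : Pb ⟶ X), P X →
    IsPullback p1 p2 (R.η.app A) x →
    IsPullback (R.F.map p1) (R.F.map p2) (R.F.map (R.η.app A)) (R.F.map x)

/-- The reflector has stable units: it preserves pullbacks of units along arbitrary
morphisms. -/
def StableUnits (R : Reflection C P) : Prop :=
  ∀ ⦃A X Pb : C⦄ (x : X ⟶ R.F.obj A) (p1 : Pb ⟶ A) (p2 : Pb ⟶ X),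
    IsPullback p1 p2 (R.η.app A) x →
    IsPullback (R.F.map p1) (R.F.map p2) (R.F.map (R.η.app A)) (R.F.map x)

/-- The reflection is admissible with respect to the class of normal epimorphisms:
the reflector preserves pullbacks of units along normal epimorphisms with domain in
the subcategory. -/
def AdmissibleN [HasZeroMorphisms C] (R : Reflection C P) : Prop :=
  ∀ ⦃A X Pb : C⦄ (x : X ⟶ R.F.obj A) (p1 : Pb ⟶ A) (p2 : Pb ⟶ X), P X →
    IsNormalEpiArrow x →
    IsPullback p1 p2 (R.η.app A) x →
    IsPullback (R.F.map p1) (R.F.map p2) (R.F.map (R.η.app A)) (R.F.map x)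

/-- The radical associated to a (normal epi)-reflection is idempotent. -/
def IdempotentRadical [HasZeroMorphisms C] (R : Reflection C P) : Prop :=
  ∀ ⦃A TA : C⦄ (t : TA ⟶ A), IsKernelOf t (R.η.app A) →
    ∀ ⦃T2 : C⦄ (t2 : T2 ⟶ TA), IsKernelOf t2 (R.η.app TA) → IsIso t2

/-- Condition (N) for a (normal epi)-reflection: for any morphism `f` with kernel
`k : K ⟶ A`, and any kernel `t : TK ⟶ K` of the unit at `K`, the composite `t ≫ k`
is a normal monomorphism. -/
def ConditionN [HasZeroMorphisms C] (R : Reflection C P) : Prop :=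
  ∀ ⦃A B : C⦄ (f : A ⟶ B) ⦃K : C⦄ (k : K ⟶ A), IsKernelOf k f →
    ∀ ⦃TK : C⦄ (t : TK ⟶ K), IsKernelOf t (R.η.app K) → IsNormalMonoArrow (t ≫ k)

/-- A torsion theory on a pointed category, given by a pair of full replete
subcategories. -/
structure TorsionTheory (C : Type u) [Category.{v} C] [HasZeroMorphisms C]
    (T F : C → Prop) : Prop where
  repleteT : Replete T
  repleteF : Replete F
  hom_zero : ∀ ⦃X Y : C⦄ (f : X ⟶ Y), T X → F Y → f = 0
  exists_ses : ∀ A : C, ∃ (TA FA : C) (t : TA ⟶ A) (q : A ⟶ FA),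
    T TA ∧ F FA ∧ IsShortExact t q

/-- Condition (N) for a torsion theory, formulated without reference to a chosen
reflector: for any morphism `f` with kernel `k : K ⟶ A` and any short exact sequence
`0 → TK → K → FK → 0` with `TK` torsion and `FK` torsion-free, the composite
`TK → A` is a normal monomorphism. -/
def TTConditionN [HasZeroMorphisms C] (T F : C → Prop) : Prop :=
  ∀ ⦃A B K TK FK : C⦄ (f : A ⟶ B) (k : K ⟶ A) (t : TK ⟶ K) (q : K ⟶ FK),
    IsKernelOf k f → T TK → F FK → IsShortExact t q → IsNormalMonoArrow (t ≫ k)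

/-- Condition (P) for a torsion theory: the torsion-free reflector is protoadditive
(formulated for every (normal epi)-reflection onto the torsion-free part). -/
def TTConditionP [HasZeroMorphisms C] (T F : C → Prop) : Prop :=
  ∀ R : Reflection C F, NormalEpiUnits R → IsProtoadditive R.F

/-- Orthogonality `e ↓ m` of two morphisms. -/
def Orthogonal {A B X Y : C} (e : A ⟶ B) (m : X ⟶ Y) : Prop :=
  ∀ (a : A ⟶ X) (b : B ⟶ Y), e ≫ b = a ≫ m →
    ∃! d : B ⟶ X, e ≫ d = a ∧ d ≫ m = b

/-- The class of morphisms orthogonal on the right to all members of `E`. -/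
def dnOrth (E : MorphismProperty C) : MorphismProperty C :=
  fun _ _ m => ∀ ⦃A B : C⦄ (e : A ⟶ B), E e → Orthogonal e m

/-- The class of morphisms orthogonal on the left to all members of `M`. -/
def upOrth (M : MorphismProperty C) : MorphismProperty C :=
  fun _ _ e => ∀ ⦃X Y : C⦄ (m : X ⟶ Y), M m → Orthogonal e m

/-- A prefactorisation system. -/
structure IsPrefactorisationSystem (E M : MorphismProperty C) : Prop where
  E_eq : E = upOrth M
  M_eq : M = dnOrth E

/-- A factorisation system. -/
structure IsFactorisationSystem (E M : MorphismProperty C) : Prop where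
  E_eq : E = upOrth M
  M_eq : M = dnOrth E
  fac : ∀ ⦃X Y : C⦄ (f : X ⟶ Y),
    ∃ (I : C) (e : X ⟶ I) (m : I ⟶ Y), E e ∧ M m ∧ e ≫ m = f

/-- A pullback-stable class of morphisms. -/
def PullbackStable (E : MorphismProperty C) : Prop :=
  ∀ ⦃P X Y Z : C⦄ (fst : P ⟶ X) (snd : P ⟶ Y) (f : X ⟶ Z) (g : Y ⟶ Z),
    IsPullback fst snd f g → E f → E snd

/-- The class of morphisms inverted by the reflector. -/
def invertedByR (R : Reflection C P) : MorphismProperty C :=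
  fun _ _ f => IsIso (R.F.map f)

/-- The class of morphisms all of whose pullbacks lie in `E` ("stably in `E`"). -/
def StablyIn (E : MorphismProperty C) : MorphismProperty C :=
  fun _ Y e => ∀ ⦃Pb W : C⦄ (fst : Pb ⟶ W) (snd : Pb ⟶ _) (g : W ⟶ Y),
    IsPullback fst snd g e → E fst

/-- The class of morphisms locally in `M`: some pullback along an effective descent
morphism lies in `M`. -/
def locallyIn [HasPullbacks C] (M : MorphismProperty C) : MorphismProperty C :=
  fun _ B f => ∃ (E : C) (p : E ⟶ B), IsEffectiveDescent p ∧
    ∃ (Pb : C) (p1 : Pb ⟶ E) (p2 : Pb ⟶ _), IsPullback p1 p2 p f ∧ M p1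

/-- The class `Ē` associated to a torsion theory: normal epimorphisms with torsion
kernel. -/
def Ebar [HasZeroMorphisms C] (T : C → Prop) : MorphismProperty C :=
  fun X _ e => IsNormalEpiArrow e ∧ ∃ (K : C) (k : K ⟶ X), IsKernelOf k e ∧ T K

/-- The class `M̄` associated to a torsion theory: morphisms with torsion-free
kernel. -/
def Mbar [HasZeroMorphisms C] (F : C → Prop) : MorphismProperty C :=
  fun X _ m => ∃ (K : C) (k : K ⟶ X), IsKernelOf k m ∧ F K

/-- A Birkhoff subcategory: a (regular epi)-reflective subcategory such that the
naturality squares of the unit at regular epimorphisms are pushouts. -/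
structure IsBirkhoff [HasZeroMorphisms C] (R : Reflection C P) : Prop where
  units_regEpi : ∀ X : C, Nonempty (RegularEpi (R.η.app X))
  pushout_units : ∀ ⦃A B : C⦄ (f : A ⟶ B), Nonempty (RegularEpi f) →
    IsPushout f (R.η.app A) (R.η.app B) (R.F.map f)

section ArrowInstances

variable [HasZeroMorphisms C]

instance instZeroArrowHom (f g : Arrow C) : Zero (f ⟶ g) :=
  ⟨{ left := 0, right := 0, w := by simp }⟩

@[simp] lemma arrowHomZero_left (f g : Arrow C) : (0 : f ⟶ g).left = 0 := rfl

@[simp] lemma arrowHomZero_right (f g : Arrow C) : (0 : f ⟶ g).right = 0 := rfl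

instance instArrowHasZeroMorphisms : HasZeroMorphisms (Arrow C) where
  comp_zero {X Y} f Z := by
    apply CommaMorphism.ext <;> simp
  zero_comp X {Y Z} f := by
    apply CommaMorphism.ext <;> simp

end ArrowInstances

section Helpers

lemma IsKernelOf.mk_exists [HasZeroMorphisms C] {K A B : C} {k : K ⟶ A} {f : A ⟶ B} (w : k ≫ f = 0)
    (h : ∀ ⦃Z : C⦄ (g : Z ⟶ A), g ≫ f = 0 → ∃! l : Z ⟶ K, l ≫ k = g) : IsKernelOf k f := by
  refine ⟨w, ⟨KernelFork.IsLimit.ofι k w (fun g hg => (h g hg).choose)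
    (fun g hg => (h g hg).choose_spec.1)
    (fun g hg l hl => (h g hg).choose_spec.2 l hl)⟩⟩

lemma IsCokernelOf.mk_exists [HasZeroMorphisms C] {K A B : C} {k : K ⟶ A} {f : A ⟶ B} (w : k ≫ f = 0)
    (h : ∀ ⦃Z : C⦄ (g : A ⟶ Z), k ≫ g = 0 → ∃! l : B ⟶ Z, f ≫ l = g) : IsCokernelOf f k := by
  refine ⟨w, ⟨CokernelCofork.IsColimit.ofπ f w (fun g hg => (h g hg).choose)
    (fun g hg => (h g hg).choose_spec.1)
    (fun g hg l hl => (h g hg).choose_spec.2 l hl)⟩⟩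

lemma IsKernelOf.lift [HasZeroMorphisms C] {K A B : C} {k : K ⟶ A} {f : A ⟶ B}
    (h : IsKernelOf k f) {Z : C} (g : Z ⟶ A) (hg : g ≫ f = 0) : ∃! l : Z ⟶ K, l ≫ k = g := by
  obtain ⟨w, ⟨hl⟩⟩ := h
  obtain ⟨l, hl'⟩ := KernelFork.IsLimit.lift' hl g hg
  refine ⟨l, hl', fun l' h' => Fork.IsLimit.hom_ext hl ?_⟩
  exact h'.trans hl'.symm

lemma IsCokernelOf.desc [HasZeroMorphisms C] {K A B : C} {k : K ⟶ A} {f : A ⟶ B}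
    (h : IsCokernelOf f k) {Z : C} (g : A ⟶ Z) (hg : k ≫ g = 0) : ∃! l : B ⟶ Z, f ≫ l = g := by
  obtain ⟨w, ⟨hl⟩⟩ := h
  obtain ⟨l, hl'⟩ := CokernelCofork.IsColimit.desc' hl g hg
  refine ⟨l, hl', fun l' h' => Cofork.IsColimit.hom_ext hl ?_⟩
  exact h'.trans hl'.symm

lemma orthogonal_of_iso_left {X Y : Arrow C} (i : X ≅ Y) {A B : C} (m : A ⟶ B)
    (h : Orthogonal X.hom m) : Orthogonal Y.hom m := by
  intro a b hab
  have h1 : i.hom.left ≫ Y.hom = X.hom ≫ i.hom.right := i.hom.w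
  have h2 : i.inv.left ≫ X.hom = Y.hom ≫ i.inv.right := i.inv.w
  have l1 : i.hom.left ≫ i.inv.left = 𝟙 _ := congrArg CommaMorphism.left i.hom_inv_id
  have l2 : i.inv.left ≫ i.hom.left = 𝟙 _ := congrArg CommaMorphism.left i.inv_hom_id
  have r1 : i.hom.right ≫ i.inv.right = 𝟙 _ := congrArg CommaMorphism.right i.hom_inv_id
  have r2 : i.inv.right ≫ i.hom.right = 𝟙 _ := congrArg CommaMorphism.right i.inv_hom_id
  obtain ⟨d, ⟨hd1, hd2⟩, hu⟩ := h (i.hom.left ≫ a) (i.hom.right ≫ b) (by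
    rw [← Category.assoc, ← h1, Category.assoc, hab, Category.assoc])
  refine ⟨i.inv.right ≫ d, ⟨?_, ?_⟩, ?_⟩
  · rw [← Category.assoc, ← h2, Category.assoc, hd1, ← Category.assoc, l2]
    exact Category.id_comp _
  · rw [Category.assoc, hd2, ← Category.assoc, r2]
    exact Category.id_comp _
  · rintro d' ⟨h3, h4⟩
    have := hu (i.hom.right ≫ d') ⟨by rw [← Category.assoc, ← h1, Category.assoc, h3],
      by rw [Category.assoc, h4]⟩
    rw [← this, ← Category.assoc, r2]
    exact (Category.id_comp _).symm

lemma orthogonal_of_iso_right {X Y : Arrow C} (i : X ≅ Y) {A B : C} (e : A ⟶ B)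
    (h : Orthogonal e X.hom) : Orthogonal e Y.hom := by
  intro a b hab
  have h1 : i.hom.left ≫ Y.hom = X.hom ≫ i.hom.right := i.hom.w
  have h2 : i.inv.left ≫ X.hom = Y.hom ≫ i.inv.right := i.inv.w
  have l1 : i.hom.left ≫ i.inv.left = 𝟙 _ := congrArg CommaMorphism.left i.hom_inv_id
  have l2 : i.inv.left ≫ i.hom.left = 𝟙 _ := congrArg CommaMorphism.left i.inv_hom_id
  have r2 : i.inv.right ≫ i.hom.right = 𝟙 _ := congrArg CommaMorphism.right i.inv_hom_id
  obtain ⟨d, ⟨hd1, hd2⟩, hu⟩ := h (a ≫ i.inv.left) (b ≫ i.inv.right) (by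
    rw [← Category.assoc, hab, Category.assoc, Category.assoc, ← h2])
  refine ⟨d ≫ i.hom.left, ⟨?_, ?_⟩, ?_⟩
  · rw [← Category.assoc, hd1, Category.assoc, l2]
    exact Category.comp_id _
  · rw [Category.assoc, h1, ← Category.assoc, hd2, Category.assoc, r2]
    exact Category.comp_id _
  · rintro d' ⟨h3, h4⟩
    have := hu (d' ≫ i.inv.left) ⟨by rw [← Category.assoc, h3],
      by rw [Category.assoc, h2, ← Category.assoc, h4]⟩
    rw [← this, Category.assoc, l2]
    exact (Category.comp_id _).symm

end Helpers

/-- Lemma 4.1. Let `C` be a pointed category with kernels of normal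
epimorphisms. Any stable factorisation system `(E, M)` on `C` in which every member of
`E` is a normal epimorphism induces a torsion theory `(T_E, F_M)` in the arrow
category: the torsion-free part consists of the arrows lying in `M`, and the torsion
part of the arrows in `E` of the form `T ⟶ 0`. -/
theorem statement15 {C : Type u} [Category.{v} C] [HasZeroObject C] [HasZeroMorphisms C]
    (hker : ∀ ⦃A B : C⦄ (f : A ⟶ B), IsNormalEpiArrow f →
      ∃ (K : C) (k : K ⟶ A), IsKernelOf k f)
    (E M : MorphismProperty C) (hfs : IsFactorisationSystem E M)
    (hstable : PullbackStable E)
    (hne : ∀ ⦃X Y : C⦄ (e : X ⟶ Y), E e → IsNormalEpiArrow e) :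
    TorsionTheory (Arrow C)
      (fun g => E g.hom ∧ IsZero g.right)
      (fun g => M g.hom) := by
  refine ⟨?_, ?_, ?_, ?_⟩
  · rintro X Y ⟨hE, hZ⟩ i
    refine ⟨?_, hZ.of_iso (Arrow.rightFunc.mapIso i).symm⟩
    rw [hfs.E_eq] at hE ⊢
    intro A B m hm
    exact orthogonal_of_iso_left i m (hE m hm)
  · intro X Y hM i
    have hM' : M X.hom := hM
    change M Y.hom
    rw [hfs.M_eq] at hM' ⊢
    intro A B e he
    exact orthogonal_of_iso_right i e (hM' e he)
  · rintro X Y f ⟨hE, hZ⟩ hM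
    have hr : f.right = 0 := hZ.eq_of_src _ _
    rw [hfs.E_eq] at hE
    obtain ⟨d, ⟨hd, -⟩, -⟩ := hE Y.hom hM f.left f.right f.w.symm
    have hd0 : d = 0 := hZ.eq_of_src _ _
    apply CommaMorphism.ext
    · exact hd.symm.trans ((congrArg (X.hom ≫ ·) hd0).trans comp_zero)
    · exact hr
  · intro f
    obtain ⟨I, e, m, he, hm, hf⟩ := hfs.fac f.hom
    obtain ⟨K, k, hk⟩ := hker e (hne e he)
    have hke : k ≫ e = 0 := hk.1
    have hcok : IsCokernelOf e k := by
      obtain ⟨K', k', hk'⟩ := hne e he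
      refine IsCokernelOf.mk_exists hke fun Z g hg => hk'.desc g ?_
      obtain ⟨l, hl, -⟩ := hk.lift k' hk'.1
      rw [← hl, Category.assoc, hg, comp_zero]
    obtain ⟨O, hz⟩ := HasZeroObject.zero (C := C)
    have hpb : IsPullback k (0 : K ⟶ O) e (0 : O ⟶ I) := by
      refine ⟨⟨by rw [hke, zero_comp]⟩, ⟨PullbackCone.IsLimit.mk _
        (fun s => (hk.lift s.fst (by rw [s.condition, comp_zero])).choose)
        (fun s => (hk.lift s.fst (by rw [s.condition, comp_zero])).choose_spec.1)
        (fun s => hz.eq_of_tgt _ _)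
        (fun s l h1 _ =>
          (hk.lift s.fst (by rw [s.condition, comp_zero])).choose_spec.2 l h1)⟩⟩
    have hE0 : E (0 : K ⟶ O) := hstable _ _ _ _ hpb he
    refine ⟨Arrow.mk (0 : K ⟶ O), Arrow.mk m,
      Arrow.homMk k 0 (by
        change k ≫ f.hom = 0 ≫ 0
        rw [← hf, ← Category.assoc, hke, zero_comp, zero_comp]),
      Arrow.homMk e (𝟙 _) (by simp [hf]), ⟨hE0, hz⟩, hm, ?_, ?_⟩
    · refine IsKernelOf.mk_exists ?_ ?_
      · apply CommaMorphism.ext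
        · exact hke
        · exact zero_comp
      · intro Z g hg
        have hgl : g.left ≫ e = 0 := congrArg CommaMorphism.left hg
        have hgr : g.right ≫ 𝟙 _ = 0 := congrArg CommaMorphism.right hg
        have hgr' : g.right = 0 := (Category.comp_id _).symm.trans hgr
        obtain ⟨l, hl, hu⟩ := hk.lift g.left hgl
        refine ⟨Arrow.homMk l 0 (hz.eq_of_tgt _ _), ?_, ?_⟩
        · apply CommaMorphism.ext
          · exact hl
          · exact zero_comp.trans hgr'.symm
        · intro l' hl'
          apply CommaMorphism.ext
          · exact hu _ (congrArg CommaMorphism.left hl')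
          · exact hz.eq_of_tgt _ _
    · refine IsCokernelOf.mk_exists ?_ ?_
      · apply CommaMorphism.ext
        · exact hke
        · exact zero_comp
      · intro Z g hg
        have hgl : k ≫ g.left = 0 := congrArg CommaMorphism.left hg
        obtain ⟨l, hl, hu⟩ := hcok.desc g.left hgl
        have hw : g.left ≫ Z.hom = f.hom ≫ g.right := g.w
        have hlw : l ≫ Z.hom = m ≫ g.right := by
          refine (hcok.desc (g.left ≫ Z.hom) ?_).unique ?_ ?_
          · rw [← Category.assoc, hgl, zero_comp]
          · rw [← Category.assoc, hl]
          · rw [← Category.assoc, hf, hw]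
        refine ⟨Arrow.homMk l g.right hlw, ?_, ?_⟩
        · apply CommaMorphism.ext
          · exact hl
          · exact Category.id_comp _
        · intro l' hl'
          apply CommaMorphism.ext
          · exact hu _ (congrArg CommaMorphism.left hl')
          · exact (Category.id_comp _).symm.trans (congrArg CommaMorphism.right hl')

end ProtoPaper
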